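/- Let N ≥ 2, 1 < p < N, p < q < ∞, p* := Np/(N−p), r > p*, and a : ℤ^N → [0,∞). Set S := inf{ I(u) : u finitely supported, Σ_x |u(x)|^r = 1 }. If v_n : ℤ^N → ℝ are finitely supported with Σ_x |v_n(x)|^r = 1 and I(v_n) → S, then liminf_{n→∞} ‖v_n‖_∞ > 0. -/

import Mathlib

open Filter Topology
open scoped ENNReal Classical

noncomputable section

abbrev ZN (N : ℕ) := Fin N → ℤ

def adj {N : ℕ} (x y : ZN N) : Prop := (∑ i, (x i - y i).natAbs) = 1

def eInt {N : ℕ} (g : ZN N → ZN N → ℝ) : ℝ≥0∞ :=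
  (∑' e : ZN N × ZN N, if adj e.1 e.2 then ENNReal.ofReal (g e.1 e.2) else 0) / 2

def grad {N : ℕ} (u : ZN N → ℝ) (x y : ZN N) : ℝ := u y - u x

def energy {N : ℕ} (p q : ℝ) (a u : ZN N → ℝ) : ℝ≥0∞ :=
  eInt (fun x y => (1 / p) * |grad u x y| ^ p + (a x / q) * |grad u x y| ^ q)

def gradModular {N : ℕ} (p q : ℝ) (a u : ZN N → ℝ) : ℝ≥0∞ :=
  eInt (fun x y => |grad u x y| ^ p + a x * |grad u x y| ^ q)

def vsum {N : ℕ} (r : ℝ) (u : ZN N → ℝ) : ℝ≥0∞ :=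
  ∑' x : ZN N, ENNReal.ofReal (|u x| ^ r)

def Slevel {N : ℕ} (p q : ℝ) (a : ZN N → ℝ) (r t : ℝ) : ℝ≥0∞ :=
  sInf { c : ℝ≥0∞ | ∃ u : ZN N → ℝ, (Function.support u).Finite ∧
      vsum r u = ENNReal.ofReal (r * t) ∧ energy p q a u = c }

def Lop {N : ℕ} (p q : ℝ) (a u : ZN N → ℝ) (x₀ : ZN N) : ℝ :=
  -(∑' y : ZN N, if adj x₀ y then |u y - u x₀| ^ (p - 2) * (u y - u x₀) else 0)
    - ∑' y : ZN N, if adj x₀ y then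
        ((a x₀ + a y) / 2) * (|u y - u x₀| ^ (q - 2) * (u y - u x₀)) else 0

/-- A discrete analogue of the bound of `x ^ γ - y ^ γ` by the mean value theorem. -/
theorem abs_rpow_sub_rpow_le {γ x y : ℝ} (hγ : 1 ≤ γ) (hx : 0 ≤ x) (hy : 0 ≤ y) :
    |x ^ γ - y ^ γ| ≤ γ * (max x y ^ (γ - 1) * |x - y|) := by
  wlog hxy : x ≤ y generalizing x y
  · rw [abs_sub_comm, max_comm, abs_sub_comm x]
    exact this hy hx (le_of_not_ge hxy)
  rcases hy.eq_or_lt with rfl | hy'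
  · obtain rfl : x = 0 := le_antisymm hxy hx
    simp
  rw [max_eq_right hxy, abs_sub_comm, abs_sub_comm x,
    abs_of_nonneg (sub_nonneg.2 (Real.rpow_le_rpow hx hxy (by linarith))),
    abs_of_nonneg (sub_nonneg.2 hxy)]
  have h1 : -1 ≤ x / y - 1 := by linarith [div_nonneg hx hy]
  have h2 := one_add_mul_self_le_rpow_one_add h1 hγ
  rw [add_sub_cancel, Real.div_rpow hx hy, le_div_iff₀ (by positivity)] at h2
  have h3 : y ^ γ = y ^ (γ - 1) * y := by
    rw [← Real.rpow_add_one hy'.ne', sub_add_cancel]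
  have h4 : (1 + γ * (x / y - 1)) * y ^ γ = y ^ γ - γ * (y ^ (γ - 1) * (y - x)) := by
    rw [h3]; field_simp; ring
  linarith

theorem ENNReal.le_rpow_of_le_mul_rpow {A C : ℝ≥0∞} {θ : ℝ} (hA : A ≠ ∞) (hθ : θ < 1)
    (h : A ≤ C * A ^ θ) : A ≤ C ^ (1 - θ)⁻¹ := by
  rcases eq_or_ne A 0 with rfl | hA0
  · simp
  rw [ENNReal.le_rpow_inv_iff (by linarith), ENNReal.rpow_sub _ _ hA0 hA, ENNReal.rpow_one]
  exact ENNReal.div_le_of_le_mul h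

theorem MeasureTheory.Measure.pi_count (ι : Type*) [Fintype ι] (α : ι → Type*)
    [∀ i, MeasurableSpace (α i)] [∀ i, Countable (α i)] [∀ i, MeasurableSingletonClass (α i)] :
    Measure.pi (fun i => (Measure.count : Measure (α i))) = Measure.count := by
  refine Measure.ext_of_singleton fun x => ?_
  rw [Measure.pi_singleton]
  simp

/-- Hölder's inequality for sums over a countable type. -/
theorem ENNReal.tsum_mul_le_Lp_mul_Lq {α : Type*} [Countable α] {p q : ℝ}
    (hpq : p.HolderConjugate q) (f g : α → ℝ≥0∞) :
    ∑' x, f x * g x ≤ (∑' x, f x ^ p) ^ (1 / p) * (∑' x, g x ^ q) ^ (1 / q) := by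
  let _ : MeasurableSpace α := ⊤
  simpa [MeasureTheory.lintegral_count] using
    ENNReal.lintegral_mul_le_Lp_mul_Lq MeasureTheory.Measure.count hpq
      (f := f) (g := g) measurable_from_top.aemeasurable measurable_from_top.aemeasurable

/-- A function on `ℤ` with a zero arbitrarily far to the left is bounded by its variation. -/
theorem edist_zero_le_tsum_edist {g : ℤ → ℝ} (hg : (Function.support g).Finite) (k : ℤ) :
    edist (g k) 0 ≤ ∑' j : ℤ, edist (g j) (g (j - 1)) := by
  obtain ⟨n, hn⟩ : ∃ n : ℕ, g (k - n) = 0 := by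
    have hinj : Function.Injective fun n : ℕ => k - (n : ℤ) := fun a b h => by
      simpa using h
    obtain ⟨n, hn⟩ := (hg.preimage hinj.injOn).exists_notMem
    exact ⟨n, by simpa using hn⟩
  have hinj : Function.Injective fun n : ℕ => k - (n : ℤ) := fun a b h => by
    simpa using h
  calc edist (g k) 0 = edist (g (k - (0 : ℕ))) (g (k - n)) := by simp [hn]
    _ ≤ ∑ j ∈ Finset.range n, edist (g (k - j)) (g (k - (j + 1 : ℕ))) :=
        edist_le_range_sum_edist (fun j : ℕ => g (k - j)) n
    _ = ∑ j ∈ Finset.range n, edist (g (k - j)) (g (k - j - 1)) := by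
        simp [sub_sub]
    _ ≤ ∑' j : ℕ, edist (g (k - j)) (g (k - j - 1)) := ENNReal.sum_le_tsum _
    _ ≤ ∑' j : ℤ, edist (g j) (g (j - 1)) :=
        ENNReal.tsum_comp_le_tsum_of_injective hinj fun j => edist (g j) (g (j - 1))

theorem adj_comm {N : ℕ} {x y : ZN N} : adj x y ↔ adj y x := by
  have (i : Fin N) : (x i - y i).natAbs = (y i - x i).natAbs := by lia
  simp only [adj, this]

theorem adj_update_sub_one {N : ℕ} (x : ZN N) (i : Fin N) (k : ℤ) :
    adj (Function.update x i k) (Function.update x i (k - 1)) := by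
  rw [adj, Finset.sum_eq_single i]
  · simp
  · intro j _ hj
    simp [hj]
  · simp

theorem adj_mem_Icc {N : ℕ} {x y : ZN N} (h : adj x y) : y ∈ Finset.Icc (x - 1) (x + 1) := by
  have h' (i : Fin N) : (x i - y i).natAbs ≤ 1 :=
    h ▸ Finset.single_le_sum (f := fun i => (x i - y i).natAbs) (fun _ _ => Nat.zero_le _)
      (Finset.mem_univ i)
  rw [Finset.mem_Icc, Pi.le_def, Pi.le_def]
  constructor <;> intro i <;> have := h' i <;> simp <;> omega

theorem tsum_adj_le {N : ℕ} (x : ZN N) (c : ℝ≥0∞) :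
    ∑' y, (if adj x y then c else 0) ≤ 3 ^ N * c := by
  rw [tsum_eq_sum (s := Finset.Icc (x - 1) (x + 1))
    fun y hy => if_neg fun h => hy (adj_mem_Icc h)]
  calc _ ≤ ∑ y ∈ Finset.Icc (x - 1) (x + 1), c := by
        gcongr; split_ifs <;> simp
    _ = 3 ^ N * c := by
        have (i : Fin N) : x i + 1 + 1 - (x i - 1) = 3 := by ring
        simp [Pi.card_Icc, this]

theorem tsum_edge_add_le {N : ℕ} (F : ZN N → ℝ≥0∞) :
    ∑' e : ZN N × ZN N, (if adj e.1 e.2 then F e.1 + F e.2 else 0)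
      ≤ 2 * 3 ^ N * ∑' x, F x := by
  have h1 : ∑' e : ZN N × ZN N, (if adj e.1 e.2 then F e.1 else 0) ≤ 3 ^ N * ∑' x, F x := by
    rw [ENNReal.tsum_prod (f := fun x y => if adj x y then F x else 0), ← ENNReal.tsum_mul_left]
    exact ENNReal.tsum_le_tsum fun x => tsum_adj_le x _
  have h2 : ∑' e : ZN N × ZN N, (if adj e.1 e.2 then F e.2 else 0) ≤ 3 ^ N * ∑' x, F x := by
    rw [← (Equiv.prodComm _ _).tsum_eq]
    simpa [adj_comm] using h1
  calc _ = ∑' e : ZN N × ZN N, (if adj e.1 e.2 then F e.1 else 0) +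
        ∑' e : ZN N × ZN N, (if adj e.1 e.2 then F e.2 else 0) := by
        rw [← ENNReal.tsum_add]
        congr! 2 with e
        split_ifs <;> simp
    _ ≤ 3 ^ N * ∑' x, F x + 3 ^ N * ∑' x, F x := add_le_add h1 h2
    _ = _ := by ring

/-- The discrete Gagliardo–Nirenberg–Sobolev inequality in the case of exponent `1`. -/
theorem tsum_edist_rpow_le_edge_sum {N : ℕ} (hN : 2 ≤ N) {g : ZN N → ℝ}
    (hg : (Function.support g).Finite) :
    ∑' x, edist (g x) 0 ^ ((N : ℝ) / (N - 1))
      ≤ (∑' e : ZN N × ZN N, if adj e.1 e.2 then edist (g e.1) (g e.2) else 0)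
        ^ ((N : ℝ) / (N - 1)) := by
  have hN' : (2 : ℝ) ≤ N := by exact_mod_cast hN
  have hconj : Real.HolderConjugate (Fintype.card (Fin N)) ((N : ℝ) / (N - 1)) := by
    rw [Fintype.card_fin]
    exact Real.HolderConjugate.conjExponent (by linarith)
  let f : ZN N → ℝ≥0∞ := fun x => ∑' y, if adj x y then edist (g x) (g y) else 0
  have key := MeasureTheory.lintegral_prod_lintegral_pow_le
    (fun _ : Fin N => (MeasureTheory.Measure.count : MeasureTheory.Measure ℤ)) hconj
    (f := f) (measurable_of_countable f)
  rw [MeasureTheory.Measure.pi_count] at key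
  simp only [MeasureTheory.lintegral_count, Fintype.card_fin] at key
  rw [ENNReal.tsum_prod (f := fun x y => if adj x y then edist (g x) (g y) else 0)]
  refine le_trans (ENNReal.tsum_le_tsum fun x => ?_) key
  have hline (i : Fin N) : edist (g x) 0 ≤ ∑' k : ℤ, f (Function.update x i k) := by
    have hfin : (Function.support fun k : ℤ => g (Function.update x i k)).Finite :=
      hg.preimage (Function.update_injective x i).injOn
    refine (by simpa using edist_zero_le_tsum_edist hfin (x i) :
      edist (g x) 0 ≤ ∑' k : ℤ,
        edist (g (Function.update x i k)) (g (Function.update x i (k - 1)))).trans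
      (ENNReal.tsum_le_tsum fun k => ?_)
    refine le_trans ?_ (ENNReal.le_tsum (Function.update x i (k - 1)))
    rw [if_pos (adj_update_sub_one x i k)]
  calc edist (g x) 0 ^ ((N : ℝ) / (N - 1))
      = ∏ _i : Fin N, edist (g x) 0 ^ ((1 : ℝ) / (N - 1)) := by
        rw [Finset.prod_const, Finset.card_univ, Fintype.card_fin, ← ENNReal.rpow_mul_natCast]
        congr 1; ring
    _ ≤ _ := by
        refine Finset.prod_le_prod' fun i _ => ENNReal.rpow_le_rpow (hline i) ?_
        exact div_nonneg zero_le_one (by linarith)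

/-- The edge sum of `|∇u| ^ p`. -/
def edgeGradSum {N : ℕ} (p : ℝ) (u : ZN N → ℝ) : ℝ≥0∞ :=
  ∑' e : ZN N × ZN N, if adj e.1 e.2 then ENNReal.ofReal (|grad u e.1 e.2| ^ p) else 0

theorem edgeGradSum_le_energy {N : ℕ} {p q : ℝ} (hp : 0 < p) (hq : 0 < q) {a : ZN N → ℝ}
    (ha : ∀ x, 0 ≤ a x) (u : ZN N → ℝ) :
    edgeGradSum p u ≤ ENNReal.ofReal p * (2 * energy p q a u) := by
  rw [energy, eInt, ENNReal.mul_div_cancel (by simp) (by simp), ← ENNReal.tsum_mul_left,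
    edgeGradSum]
  refine ENNReal.tsum_le_tsum fun e => ?_
  split_ifs
  · rw [← ENNReal.ofReal_mul hp.le]
    refine ENNReal.ofReal_le_ofReal ?_
    have h1 : 0 ≤ a e.1 / q * |grad u e.1 e.2| ^ q :=
      mul_nonneg (div_nonneg (ha _) hq.le) (by positivity)
    have h2 : p * (1 / p * |grad u e.1 e.2| ^ p) = |grad u e.1 e.2| ^ p := by field_simp
    nlinarith [mul_nonneg hp.le h1]
  · simp

theorem energy_ne_top {N : ℕ} {p q : ℝ} (hp : p ≠ 0) (hq : q ≠ 0) (a : ZN N → ℝ) {u : ZN N → ℝ}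
    (hu : (Function.support u).Finite) : energy p q a u ≠ ∞ := by
  refine ENNReal.div_ne_top ?_ (by simp)
  have hfin : (⋃ x ∈ Function.support u, ((fun y => (x, y)) '' (Finset.Icc (x - 1) (x + 1) : Set _))
      ∪ ((fun y => (y, x)) '' (Finset.Icc (x - 1) (x + 1) : Set _))).Finite :=
    hu.biUnion fun x _ => ((Finset.finite_toSet _).image _).union ((Finset.finite_toSet _).image _)
  rw [tsum_eq_sum (s := hfin.toFinset)]
  · refine (ENNReal.sum_lt_top.2 fun e _ => ?_).ne
    split_ifs <;> simp
  · rintro ⟨x, y⟩ hxy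
    refine ite_eq_right_iff.2 fun h => ?_
    have hx : u x = 0 := by
      by_contra hx
      refine hxy (hfin.mem_toFinset.2 (Set.mem_biUnion hx (.inl ⟨y, ?_, rfl⟩)))
      exact adj_mem_Icc h
    have hy : u y = 0 := by
      by_contra hy
      refine hxy (hfin.mem_toFinset.2 (Set.mem_biUnion hy (.inr ⟨x, ?_, rfl⟩)))
      exact adj_mem_Icc (adj_comm.1 h)
    simp [grad, hx, hy, Real.zero_rpow hp, Real.zero_rpow hq]

theorem vsum_ne_top {N : ℕ} {s : ℝ} (hs : s ≠ 0) {u : ZN N → ℝ}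
    (hu : (Function.support u).Finite) : vsum s u ≠ ∞ := by
  rw [vsum, tsum_eq_sum (s := hu.toFinset)]
  · exact (ENNReal.sum_lt_top.2 fun e _ => ENNReal.ofReal_lt_top).ne
  · intro x hx
    have : u x = 0 := by simpa using hx
    simp [this, Real.zero_rpow hs]

theorem edge_sum_edist_rpow_le {N : ℕ} {p p' γ s : ℝ} (hpp : p'.HolderConjugate p) (hγ : 1 ≤ γ)
    (hs : (γ - 1) * p' = s) (u : ZN N → ℝ) :
    ∑' e : ZN N × ZN N, (if adj e.1 e.2 then edist (|u e.1| ^ γ) (|u e.2| ^ γ) else 0)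
      ≤ ENNReal.ofReal γ * ((2 * 3 ^ N * vsum s u) ^ (1 / p') * edgeGradSum p u ^ (1 / p)) := by
  let P : ZN N × ZN N → ℝ≥0∞ := fun e =>
    if adj e.1 e.2 then ENNReal.ofReal (max |u e.1| |u e.2| ^ (γ - 1)) else 0
  let Q : ZN N × ZN N → ℝ≥0∞ := fun e =>
    if adj e.1 e.2 then ENNReal.ofReal |grad u e.1 e.2| else 0
  have hP : ∑' e, P e ^ p' ≤ 2 * 3 ^ N * vsum s u := by
    refine le_trans (ENNReal.tsum_le_tsum fun e => ?_)
      (tsum_edge_add_le fun x => ENNReal.ofReal (|u x| ^ s))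
    simp only [P]
    split_ifs
    · rw [ENNReal.ofReal_rpow_of_nonneg (by positivity) hpp.nonneg, ← Real.rpow_mul (by positivity),
        hs]
      rcases max_choice |u e.1| |u e.2| with h | h <;> rw [h] <;> simp
    · simp [hpp.pos]
  have hQ : ∑' e, Q e ^ p = edgeGradSum p u := by
    refine tsum_congr fun e => ?_
    simp only [Q]
    split_ifs
    · rw [ENNReal.ofReal_rpow_of_nonneg (by positivity) hpp.symm.nonneg]
    · simp [hpp.symm.pos]
  calc _ ≤ ∑' e, ENNReal.ofReal γ * (P e * Q e) := by
        refine ENNReal.tsum_le_tsum fun e => ?_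
        simp only [P, Q]
        split_ifs
        · rw [edist_dist, Real.dist_eq, ← ENNReal.ofReal_mul (by positivity),
            ← ENNReal.ofReal_mul (by positivity)]
          refine ENNReal.ofReal_le_ofReal
            ((abs_rpow_sub_rpow_le hγ (abs_nonneg _) (abs_nonneg _)).trans ?_)
          have : |(|u e.1| - |u e.2|)| ≤ |grad u e.1 e.2| := by
            rw [grad, abs_sub_comm (u e.2)]
            exact abs_abs_sub_abs_le _ _
          gcongr
        · simp
    _ = ENNReal.ofReal γ * ∑' e, P e * Q e := ENNReal.tsum_mul_left
    _ ≤ ENNReal.ofReal γ * ((∑' e, P e ^ p') ^ (1 / p') * (∑' e, Q e ^ p) ^ (1 / p)) := by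
        gcongr
        exact ENNReal.tsum_mul_le_Lp_mul_Lq hpp P Q
    _ ≤ _ := by
        rw [hQ]
        gcongr
        exact one_div_nonneg.2 hpp.nonneg

/-- The discrete Sobolev inequality, in the form of a bound depending only on the gradient sum. -/
theorem exists_vsum_le_of_edgeGradSum_le {N : ℕ} (hN : 2 ≤ N) {p : ℝ} (hp : 1 < p)
    (hpN : p < N) {B : ℝ≥0∞} (hB : B ≠ ∞) :
    ∃ K : ℝ≥0∞, K ≠ ∞ ∧ ∀ u : ZN N → ℝ, (Function.support u).Finite → edgeGradSum p u ≤ B →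
      vsum ((N : ℝ) * p / (N - p)) u ≤ K := by
  have hN' : (2 : ℝ) ≤ N := by exact_mod_cast hN
  have hNp : 0 < (N : ℝ) - p := by linarith
  have hN1 : 0 < (N : ℝ) - 1 := by linarith
  have hp1 : 0 < p - 1 := by linarith
  set s : ℝ := N * p / (N - p) with hs
  set γ : ℝ := p * (N - 1) / (N - p) with hγ
  set p' : ℝ := p / (p - 1) with hp'
  set σ : ℝ := N / (N - 1) with hσ
  have hσ0 : 0 < σ := by positivity
  have hs0 : 0 < s := by positivity
  have hpp : p'.HolderConjugate p := (Real.HolderConjugate.conjExponent hp).symm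
  have hγ1 : 1 ≤ γ := by
    rw [hγ, le_div_iff₀ hNp]; nlinarith
  have hγs : (γ - 1) * p' = s := by
    rw [hγ, hp', hs]; field_simp; ring
  have hγσ : γ * σ = s := by
    rw [hγ, hσ, hs]; field_simp
  have hθ : 1 / p' * σ < 1 := by
    rw [hp', hσ, one_div_div, div_mul_div_comm, div_lt_one (by positivity)]; nlinarith
  let C : ℝ≥0∞ := (ENNReal.ofReal γ * ((2 * 3 ^ N) ^ (1 / p') * B ^ (1 / p))) ^ σ
  have hC : C ≠ ∞ := by
    refine ENNReal.rpow_ne_top_of_nonneg hσ0.le (ENNReal.mul_ne_top ENNReal.ofReal_ne_top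
      (ENNReal.mul_ne_top (ENNReal.rpow_ne_top_of_nonneg (one_div_nonneg.2 hpp.nonneg) ?_)
        (ENNReal.rpow_ne_top_of_nonneg (by positivity) hB)))
    exact ENNReal.mul_ne_top (by simp) (by simp)
  refine ⟨C ^ (1 - 1 / p' * σ)⁻¹,
    ENNReal.rpow_ne_top_of_nonneg (inv_nonneg.2 (by linarith)) hC, fun u hu huB => ?_⟩
  refine ENNReal.le_rpow_of_le_mul_rpow (vsum_ne_top hs0.ne' hu) hθ ?_
  have hg : (Function.support fun x => |u x| ^ γ).Finite := by
    refine hu.subset fun x hx hux => hx ?_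
    simp [hux, Real.zero_rpow (by linarith : γ ≠ 0)]
  calc vsum s u = ∑' x, edist (|u x| ^ γ) 0 ^ σ := by
        refine tsum_congr fun x => ?_
        rw [edist_dist, Real.dist_eq, sub_zero, abs_of_nonneg (Real.rpow_nonneg (abs_nonneg (u x)) γ),
          ENNReal.ofReal_rpow_of_nonneg (by positivity) hσ0.le, ← Real.rpow_mul (by positivity),
          hγσ]
    _ ≤ _ := tsum_edist_rpow_le_edge_sum hN hg
    _ ≤ (ENNReal.ofReal γ * ((2 * 3 ^ N * vsum s u) ^ (1 / p') * B ^ (1 / p))) ^ σ := by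
        refine ENNReal.rpow_le_rpow ((edge_sum_edist_rpow_le hpp hγ1 hγs u).trans ?_) hσ0.le
        gcongr
    _ = C * vsum s u ^ (1 / p' * σ) := by
        rw [ENNReal.mul_rpow_of_nonneg (2 * 3 ^ N) _ (one_div_nonneg.2 hpp.nonneg),
          ENNReal.rpow_mul, ← ENNReal.mul_rpow_of_nonneg _ _ hσ0.le]
        congr 1; ring

theorem vsum_le_iSup_rpow_mul_vsum {N : ℕ} {s r : ℝ} (hs : 0 < s) (hsr : s ≤ r) (u : ZN N → ℝ) :
    vsum r u ≤ (⨆ x, ENNReal.ofReal |u x|) ^ (r - s) * vsum s u := by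
  rw [vsum, vsum, ← ENNReal.tsum_mul_left]
  refine ENNReal.tsum_le_tsum fun x => ?_
  rw [← ENNReal.ofReal_rpow_of_nonneg (abs_nonneg _) (hs.le.trans hsr),
    ← ENNReal.ofReal_rpow_of_nonneg (abs_nonneg _) hs.le, ← sub_add_cancel r s,
    ENNReal.rpow_add_of_nonneg _ _ (sub_nonneg.2 hsr) hs.le, add_sub_cancel_right]
  gcongr
  exact le_iSup (fun x => ENNReal.ofReal |u x|) x

/-- minimizing sequences do not vanish in `ℓ^∞`:
if `Σ_x |v_n(x)|^r = 1` and `I(v_n) → S`, then `liminf_n ‖v_n‖_∞ > 0`. -/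
theorem statement18 {N : ℕ} (hN : 2 ≤ N) (p q : ℝ) (hp : 1 < p) (hpN : p < (N : ℝ))
    (hpq : p < q) (pstar : ℝ) (hpstar : pstar = (N : ℝ) * p / ((N : ℝ) - p))
    (r : ℝ) (hr : pstar < r)
    (a : ZN N → ℝ) (ha : ∀ x, 0 ≤ a x)
    (v : ℕ → ZN N → ℝ) (hvfin : ∀ n, (Function.support (v n)).Finite)
    (hvr : ∀ n, vsum r (v n) = 1)
    (hvmin : Tendsto (fun n => energy p q a (v n)) atTop
      (𝓝 (sInf { c : ℝ≥0∞ | ∃ u : ZN N → ℝ, (Function.support u).Finite ∧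
          vsum r u = 1 ∧ energy p q a u = c }))) :
    0 < Filter.liminf (fun n => ⨆ x : ZN N, ENNReal.ofReal |v n x|) atTop := by
  have hs0 : 0 < pstar := by
    rw [hpstar]; exact div_pos (by nlinarith) (by linarith)
  have hrs : 0 < r - pstar := by linarith
  set S := sInf { c : ℝ≥0∞ | ∃ u : ZN N → ℝ, (Function.support u).Finite ∧
    vsum r u = 1 ∧ energy p q a u = c }
  have hS_top : S ≠ ∞ := by
    have h : S ≤ energy p q a (v 0) := sInf_le ⟨v 0, hvfin 0, hvr 0, rfl⟩
    exact ne_top_of_le_ne_top (energy_ne_top (by linarith) (by linarith) a (hvfin 0)) h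
  obtain ⟨K, hK, hKv⟩ := exists_vsum_le_of_edgeGradSum_le hN hp hpN
    (B := ENNReal.ofReal p * (2 * (S + 1)))
    (ENNReal.mul_ne_top ENNReal.ofReal_ne_top (ENNReal.mul_ne_top (by simp) (by simp [hS_top])))
  rw [← hpstar] at hKv
  have hpos : 0 < K⁻¹ ^ (r - pstar)⁻¹ :=
    ENNReal.rpow_pos_of_nonneg (ENNReal.inv_pos.2 hK) (inv_nonneg.2 hrs.le)
  refine hpos.trans_le (le_liminf_of_le (by isBoundedDefault) ?_)
  have hlt : S < S + 1 := ENNReal.lt_add_right hS_top one_ne_zero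
  filter_upwards [hvmin.eventually_lt_const hlt] with n hn
  have hvn : vsum pstar (v n) ≤ K := by
    refine hKv _ (hvfin n)
      ((edgeGradSum_le_energy (q := q) (by linarith) (by linarith) ha _).trans ?_)
    gcongr
  have h1 := vsum_le_iSup_rpow_mul_vsum hs0 hr.le (v n)
  rw [hvr n] at h1
  rw [ENNReal.rpow_inv_le_iff hrs, ← one_div]
  exact ENNReal.div_le_of_le_mul (h1.trans (by gcongr))
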